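/- arXiv:math/9806046 — 3 statements merged into one kernel-verified Lean document; each statement's English description precedes it below -/
import Mathlib

section
/- Let (T,F) be a torsion theory on an abelian category 𝒜 and let D be the derived category of 𝒜 (with H^i denoting the i-th cohomology functor). Suppose X ∈ D satisfies H^i(X) = 0 for i > 0 and H^0(X) ∈ T, and Y ∈ D satisfies H^i(Y) = 0 for i < 0 and H^0(Y) ∈ F. Then Hom_D(X,Y) = 0. -/
open CategoryTheory Limits Pretriangulated

universe w v u

/-- Let `(T,F)` be a torsion theory on an abelian category `𝒜` and `D` its derived
category.  If `X` satisfies `H^i(X) = 0` for `i > 0` and `H^0(X) ∈ T`, and `Y`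
satisfies `H^i(Y) = 0` for `i < 0` and `H^0(Y) ∈ F`, then `Hom_D(X,Y) = 0`. -/
theorem hom_vanishing_perverse
    {𝒜 : Type u} [Category.{v} 𝒜] [Abelian 𝒜] [HasDerivedCategory.{w} 𝒜]
    (T F : 𝒜 → Prop)
    (hT_iso : ∀ {X Y : 𝒜}, (X ≅ Y) → T X → T Y)
    (hF_iso : ∀ {X Y : 𝒜}, (X ≅ Y) → F X → F Y)
    (horth : ∀ (X Y : 𝒜), T X → F Y → ∀ f : X ⟶ Y, f = 0)
    (hdec : ∀ A : 𝒜, ∃ (X Y : 𝒜) (i : X ⟶ A) (p : A ⟶ Y) (w : i ≫ p = 0),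
      T X ∧ F Y ∧ (ShortComplex.mk i p w).ShortExact)
    (X Y : DerivedCategory 𝒜)
    (hX₁ : ∀ i : ℤ, 0 < i → IsZero ((DerivedCategory.homologyFunctor 𝒜 i).obj X))
    (hX₂ : T ((DerivedCategory.homologyFunctor 𝒜 0).obj X))
    (hY₁ : ∀ i : ℤ, i < 0 → IsZero ((DerivedCategory.homologyFunctor 𝒜 i).obj Y))
    (hY₂ : F ((DerivedCategory.homologyFunctor 𝒜 0).obj Y)) :
    ∀ f : X ⟶ Y, f = 0 := by
  intro f
  have hXle : X.IsLE 0 := (DerivedCategory.isLE_iff X 0).2 hX₁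
  have hYge : Y.IsGE 0 := (DerivedCategory.isGE_iff Y 0).2 hY₁
  obtain ⟨X', X'', hX', hX'', a, b, c, hTX⟩ :=
    DerivedCategory.TStructure.t.exists_triangle X (-1) 0 (by lia)
  obtain ⟨Y', Y'', hY', hY'', a', b', c', hTY⟩ :=
    DerivedCategory.TStructure.t.exists_triangle Y 0 1 (by lia)
  have hX' : X'.IsLE (-1) := ⟨hX'⟩
  have hX'' : X''.IsGE 0 := ⟨hX''⟩
  have hY' : Y'.IsLE 0 := ⟨hY'⟩
  have hY'' : Y''.IsGE 1 := ⟨hY''⟩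
  -- factorisation through the truncations
  obtain ⟨f', hf'⟩ : ∃ f' : X'' ⟶ Y, f = b ≫ f' :=
    Triangle.yoneda_exact₂ _ hTX f
      (DerivedCategory.TStructure.t.zero (a ≫ f) (-1) 0 (by lia))
  -- the truncation `X''` is concentrated in degree zero
  have hX''le : X''.IsLE 0 := by
    rw [DerivedCategory.isLE_iff]
    intro i hi
    exact (DerivedCategory.HomologySequence.exact₃ _ hTX i (i + 1) rfl).isZero_of_both_zeros
      ((hX₁ i hi).eq_of_src _ _)
      ((DerivedCategory.isZero_of_isLE X' (-1) (i + 1) (by lia)).eq_of_tgt _ _)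
  obtain ⟨f'', hf''⟩ : ∃ f'' : X'' ⟶ Y', f' = f'' ≫ a' :=
    Triangle.coyoneda_exact₂ _ hTY f'
      (DerivedCategory.TStructure.t.zero (f' ≫ b') 0 1 (by lia))
  have hY'ge : Y'.IsGE 0 := by
    rw [DerivedCategory.isGE_iff]
    intro i hi
    exact (DerivedCategory.HomologySequence.exact₁ _ hTY (i - 1) i (by lia)).isZero_of_both_zeros
      ((DerivedCategory.isZero_of_isGE Y'' 1 (i - 1) (by lia)).eq_of_src _ _)
      ((hY₁ i hi).eq_of_tgt _ _)
  -- comparison of the degree zero homology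
  have hb : IsIso ((DerivedCategory.homologyFunctor 𝒜 0).map b) := by
    have : Mono ((DerivedCategory.homologyFunctor 𝒜 0).map b) :=
      (DerivedCategory.HomologySequence.mono_homologyMap_mor₂_iff _ hTX 0).2
        ((DerivedCategory.isZero_of_isLE X' (-1) 0 (by lia)).eq_of_src _ _)
    have : Epi ((DerivedCategory.homologyFunctor 𝒜 0).map b) :=
      (DerivedCategory.HomologySequence.epi_homologyMap_mor₂_iff _ hTX 0 1 (by lia)).2
        ((DerivedCategory.isZero_of_isLE X' (-1) 1 (by lia)).eq_of_tgt _ _)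
    exact isIso_of_mono_of_epi _
  have ha' : IsIso ((DerivedCategory.homologyFunctor 𝒜 0).map a') := by
    have : Mono ((DerivedCategory.homologyFunctor 𝒜 0).map a') :=
      (DerivedCategory.HomologySequence.mono_homologyMap_mor₁_iff _ hTY (-1) 0 (by lia)).2
        ((DerivedCategory.isZero_of_isGE Y'' 1 (-1) (by lia)).eq_of_src _ _)
    have : Epi ((DerivedCategory.homologyFunctor 𝒜 0).map a') :=
      (DerivedCategory.HomologySequence.epi_homologyMap_mor₁_iff _ hTY 0).2
        ((DerivedCategory.isZero_of_isGE Y'' 1 0 (by lia)).eq_of_tgt _ _)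
    exact isIso_of_mono_of_epi _
  obtain ⟨A, ⟨eA⟩⟩ := DerivedCategory.exists_iso_singleFunctor_obj_of_isGE_of_isLE X'' 0
  obtain ⟨B, ⟨eB⟩⟩ := DerivedCategory.exists_iso_singleFunctor_obj_of_isGE_of_isLE Y' 0
  have hA : T A := hT_iso
    (asIso ((DerivedCategory.homologyFunctor 𝒜 0).map b) ≪≫
      (DerivedCategory.homologyFunctor 𝒜 0).mapIso eA ≪≫
      (DerivedCategory.singleFunctorCompHomologyFunctorIso 𝒜 0).app A) hX₂
  have hB : F B := hF_iso
    ((asIso ((DerivedCategory.homologyFunctor 𝒜 0).map a')).symm ≪≫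
      (DerivedCategory.homologyFunctor 𝒜 0).mapIso eB ≪≫
      (DerivedCategory.singleFunctorCompHomologyFunctorIso 𝒜 0).app B) hY₂
  obtain ⟨g, hg⟩ := (DerivedCategory.singleFunctor 𝒜 0).map_surjective (eA.inv ≫ f'' ≫ eB.hom)
  have hf0 : f'' = 0 := by
    rw [horth A B hA hB g, Functor.map_zero] at hg
    rw [← cancel_epi eA.inv, ← cancel_mono eB.hom, Category.assoc, ← hg]
    simp
  rw [hf', hf'', hf0, zero_comp, comp_zero]
end

section
/- Let k be a field, 𝒜 a k-linear abelian category with enough injectives, N ∈ 𝒜, and D the derived category of 𝒜. Assume: (a) Ext^i(A,N) = 0 for every A ∈ 𝒜 and every i ≥ 3; and (b) Ext²(A,N) = 0 for every A ∈ 𝒜 such that Hom(T,A) = 0 for all T ∈ 𝒜 with Hom(T,N) = 0. Let Z ∈ D be an object with bounded cohomology satisfying H^i(Z) = 0 for i < 0 and H^0(Z) ∈ F, where F = {A ∈ 𝒜 : Hom(T,A) = 0 for all T with Hom(T,N) = 0}. Then Hom_D(Z, N[0][j]) = 0 for all j ≥ 2 (i.e. Hom^j(Z,N) = 0 for j ≥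 2). -/
open CategoryTheory Limits Pretriangulated

universe w w' v u u'

section Aux

open DerivedCategory

variable {𝒜 : Type u} [Category.{v} 𝒜] [Abelian 𝒜] [HasDerivedCategory.{w} 𝒜]

lemma aux_single [HasExt.{w'} 𝒜] (A N : 𝒜) (n j : ℤ) (m : ℕ) (hm : j + n = m)
    (h : Subsingleton (Abelian.Ext A N m))
    (f : (singleFunctor 𝒜 n).obj A ⟶ ((singleFunctor 𝒜 0).obj N)⟦j⟧) : f = 0 := by
  have hs : Subsingleton (((singleFunctor 𝒜 0).obj A) ⟶
      ((singleFunctor 𝒜 0).obj N)⟦(m : ℤ)⟧) :=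
    (Abelian.Ext.homEquiv (X := A) (Y := N) (n := m)).symm.subsingleton
  apply (shiftFunctor (DerivedCategory 𝒜) n).map_injective
  rw [Functor.map_zero]
  let e : ((singleFunctor 𝒜 n).obj A)⟦n⟧ ≅ (singleFunctor 𝒜 0).obj A :=
    ((singleFunctors 𝒜).shiftIso n 0 n (by simp)).app A
  let e' := (shiftFunctorAdd' (DerivedCategory 𝒜) j n m hm).app ((singleFunctor 𝒜 0).obj N)
  rw [← cancel_epi e.inv, ← cancel_mono e'.inv]
  exact hs.elim _ _

lemma aux_triangle (Z : DerivedCategory 𝒜) (n b : ℤ) [hge : Z.IsGE n] [hle : Z.IsLE b] :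
    ∃ (X Y : DerivedCategory 𝒜) (f : X ⟶ Z) (g : Z ⟶ Y) (h : Y ⟶ X⟦(1 : ℤ)⟧),
      Triangle.mk f g h ∈ distTriang (DerivedCategory 𝒜) ∧ X.IsGE n ∧ X.IsLE n ∧
      Y.IsGE (n + 1) ∧ Y.IsLE b ∧ Mono ((homologyFunctor 𝒜 n).map f) := by
  obtain ⟨X, Y, hX, hY, f, g, h, hT⟩ := TStructure.t.exists_triangle Z n (n + 1) rfl
  have hX : X.IsLE n := ⟨hX⟩
  have hY : Y.IsGE (n + 1) := ⟨hY⟩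
  refine ⟨X, Y, f, g, h, hT, ?_, hX, hY, ?_, ?_⟩
  · rw [isGE_iff]
    intro i hi
    exact (HomologySequence.exact₁ _ hT (i - 1) i (by lia)).isZero_of_both_zeros
      ((Y.isZero_of_isGE (n + 1) (i - 1) (by lia)).eq_of_src _ _)
      ((Z.isZero_of_isGE n i hi).eq_of_tgt _ _)
  · rw [isLE_iff]
    intro i hi
    by_cases hin : i < n + 1
    · exact Y.isZero_of_isGE (n + 1) i hin
    · exact (HomologySequence.exact₃ _ hT i (i + 1) rfl).isZero_of_both_zeros
        ((Z.isZero_of_isLE b i hi).eq_of_src _ _)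
        ((X.isZero_of_isLE n (i + 1) (by lia)).eq_of_tgt _ _)
  · exact (HomologySequence.mono_homologyMap_mor₁_iff _ hT (n - 1) n (by lia)).2
      ((Y.isZero_of_isGE (n + 1) (n - 1) (by lia)).eq_of_src _ _)

lemma aux_pos [HasExt.{w'} 𝒜] (N : 𝒜)
    (ha : ∀ (A : 𝒜) (i : ℕ), 3 ≤ i → Subsingleton (Abelian.Ext A N i))
    (b j : ℤ) (hj : 2 ≤ j) (m : ℕ) :
    ∀ (n : ℤ) (_ : 1 ≤ n) (_ : b < n + m) (Z : DerivedCategory 𝒜) (_ : Z.IsGE n) (_ : Z.IsLE b)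
      (f : Z ⟶ ((singleFunctor 𝒜 0).obj N)⟦j⟧), f = 0 := by
  induction m with
  | zero =>
    intro n _ hb Z _ _ f
    exact (TStructure.t.isZero Z b n (by simpa using hb)).eq_of_src _ _
  | succ m ih =>
    intro n hn hb Z _ _ φ
    obtain ⟨X, Y, f, g, h, hT, _, _, hY, hY', _⟩ := aux_triangle Z n b
    obtain ⟨A, ⟨e⟩⟩ := exists_iso_singleFunctor_obj_of_isGE_of_isLE X n
    have h0 : f ≫ φ = 0 := by
      rw [← cancel_epi e.inv, comp_zero]
      exact aux_single A N n j (j + n).toNat (by lia) (ha _ _ (by lia)) _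
    obtain ⟨ψ, hψ⟩ : ∃ ψ : Y ⟶ _, φ = g ≫ ψ := Triangle.yoneda_exact₂ _ hT φ h0
    rw [hψ, ih (n + 1) (by lia) (by push_cast at hb; lia) Y hY hY' ψ, comp_zero]

end Aux

/-- Let `k` be a field, `𝒜` a `k`-linear abelian category with enough injectives and
`N ∈ 𝒜`.  Assume `Ext^i(A,N) = 0` for all `A` and `i ≥ 3`, and `Ext²(A,N) = 0` for all
`A ∈ F` (where `T = {T : Hom(T,N) = 0}` and `F = T^⊥`).  If `Z` is an object of the
derived category with bounded cohomology, `H^i(Z) = 0` for `i < 0` and `H^0(Z) ∈ F`,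
then `Hom_D(Z, N[0][j]) = 0` for all `j ≥ 2`. -/
theorem hom_to_single_vanishes_in_high_degrees
    {k : Type u'} [Field k]
    {𝒜 : Type u} [Category.{v} 𝒜] [Abelian 𝒜] [Linear k 𝒜] [EnoughInjectives 𝒜]
    [HasDerivedCategory.{w} 𝒜] [HasExt.{w'} 𝒜]
    (N : 𝒜)
    (ha : ∀ (A : 𝒜) (i : ℕ), 3 ≤ i → Subsingleton (Abelian.Ext A N i))
    (hb : ∀ A : 𝒜, (∀ X : 𝒜, (∀ g : X ⟶ N, g = 0) → ∀ h : X ⟶ A, h = 0) →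
      Subsingleton (Abelian.Ext A N 2))
    (Z : DerivedCategory 𝒜)
    (hbd : ∃ a b : ℤ, ∀ i : ℤ, (i < a ∨ b < i) →
      IsZero ((DerivedCategory.homologyFunctor 𝒜 i).obj Z))
    (hZ₁ : ∀ i : ℤ, i < 0 → IsZero ((DerivedCategory.homologyFunctor 𝒜 i).obj Z))
    (hZ₂ : ∀ X : 𝒜, (∀ g : X ⟶ N, g = 0) →
      ∀ h : X ⟶ (DerivedCategory.homologyFunctor 𝒜 0).obj Z, h = 0) :
    ∀ j : ℤ, 2 ≤ j →
      ∀ f : Z ⟶ ((DerivedCategory.singleFunctor 𝒜 0).obj N)⟦j⟧, f = 0 := by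
  obtain ⟨a, b, hab⟩ := hbd
  intro j hj φ
  have : Z.IsGE 0 := (DerivedCategory.isGE_iff _ _).2 hZ₁
  have : Z.IsLE b := (DerivedCategory.isLE_iff _ _).2 fun i hi ↦ hab i (Or.inr hi)
  obtain ⟨X, Y, f, g, h, hT, _, _, hY, hY', hf⟩ := aux_triangle Z 0 b
  obtain ⟨A, ⟨e⟩⟩ := DerivedCategory.exists_iso_singleFunctor_obj_of_isGE_of_isLE X 0
  have h0 : f ≫ φ = 0 := by
    rw [← cancel_epi e.inv, comp_zero]
    refine aux_single A N 0 j j.toNat (by lia) ?_ _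
    by_cases hj2 : j = 2
    · subst hj2
      refine hb A fun T hT' p ↦ ?_
      let e₂ : A ≅ (DerivedCategory.homologyFunctor 𝒜 0).obj X :=
        ((DerivedCategory.singleFunctorCompHomologyFunctorIso 𝒜 0).app A).symm ≪≫
          (DerivedCategory.homologyFunctor 𝒜 0).mapIso e.symm
      rw [← cancel_mono e₂.hom,
        ← cancel_mono ((DerivedCategory.homologyFunctor 𝒜 0).map f), zero_comp, zero_comp]
      exact hZ₂ T hT' _
    · exact ha _ _ (by lia)
  obtain ⟨ψ, hψ⟩ : ∃ ψ : Y ⟶ _, φ = g ≫ ψ := Triangle.yoneda_exact₂ _ hT φ h0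
  rw [hψ, aux_pos N ha b j hj b.toNat (0 + 1) (by lia) (by lia) Y hY hY' ψ, comp_zero]
end

section
/- Let k be a field, 𝒜 a k-linear abelian category with enough injectives, N ∈ 𝒜, and D the derived category of 𝒜. Assume: (a) Ext^i(A,N) = 0 for every A ∈ 𝒜 and every i ≥ 3; and (b) Ext²(A,N) = 0 for every A ∈ F, where F = {A ∈ 𝒜 : Hom(T,A) = 0 for all T with Hom(T,N) = 0}, and set T = {T ∈ 𝒜 : Hom(T,N) = 0}. Let Y → X → Z → Y[1] be a distinguished triangle in D of objects with bounded cohomology such that Y ∈ D^p_{≤0} (i.e. H^i(Y) = 0 for i > 0 and H^0(Y) ∈ T) and Z ∈ D^p_{≥1} (i.e. H^i(Z) = 0 for i < 0 and H^0(Z) ∈ F). If Hom_D(X, N[0][i]) = 0 for all integers i, then Hom_D(Y, N[0][i]) = 0 for all i and Hom_D(Z, N[0][i]) = 0 for all i. (Hence the perverse truncations of an object of S = {A ∈ D : RHom(A,N) = 0} again lie in S, so the perverse t-structure induces a t-structure on S.) -/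
open CategoryTheory Limits Pretriangulated

universe w w' v u u'


namespace PervOrth

open DerivedCategory

variable {𝒜 : Type u} [Category.{v} 𝒜] [Abelian 𝒜] [HasDerivedCategory.{w} 𝒜]

/-- Homs from `W` shifted by `a` are determined by homs from `W`. -/
lemma shift_hom_zero (W M : DerivedCategory 𝒜) (a i j : ℤ) (h : i + a = j)
    (hW : ∀ f : W ⟶ M⟦i⟧, f = 0) (g : W⟦a⟧ ⟶ M⟦j⟧) : g = 0 := by
  obtain ⟨g', hg'⟩ := (shiftFunctor (DerivedCategory 𝒜) a).map_surjective
    (g ≫ (shiftFunctorAdd' (DerivedCategory 𝒜) i a j h).hom.app M)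
  rw [hW g', Functor.map_zero] at hg'
  rw [← cancel_mono ((shiftFunctorAdd' (DerivedCategory 𝒜) i a j h).hom.app M), ← hg', zero_comp]

/-- Converse direction. -/
lemma hom_zero_of_shift (W M : DerivedCategory 𝒜) (a i j : ℤ) (h : i + a = j)
    (hW : ∀ g : W⟦a⟧ ⟶ M⟦j⟧, g = 0) (f : W ⟶ M⟦i⟧) : f = 0 := by
  apply (shiftFunctor (DerivedCategory 𝒜) a).map_injective
  have := hW ((shiftFunctor (DerivedCategory 𝒜) a).map f ≫
    (shiftFunctorAdd' (DerivedCategory 𝒜) i a j h).inv.app M)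
  rw [← cancel_mono ((shiftFunctorAdd' (DerivedCategory 𝒜) i a j h).inv.app M), this,
    Functor.map_zero, zero_comp]

lemma devissage {W₁ W₂ W₃ M : DerivedCategory 𝒜} {f : W₁ ⟶ W₂} {g : W₂ ⟶ W₃}
    {h : W₃ ⟶ W₁⟦(1 : ℤ)⟧} (hT : Triangle.mk f g h ∈ distTriang (DerivedCategory 𝒜))
    (h₁ : ∀ a : W₁ ⟶ M, a = 0) (h₃ : ∀ a : W₃ ⟶ M, a = 0) (a : W₂ ⟶ M) : a = 0 := by
  obtain ⟨b, hb⟩ := Triangle.yoneda_exact₂ _ hT a (h₁ _)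
  rw [hb, h₃ b]
  exact comp_zero

lemma ext_zero [HasExt.{w'} 𝒜] (A N : 𝒜) (m : ℕ) (j : ℤ) (hj : (m : ℤ) = j)
    (hm : Subsingleton (Abelian.Ext A N m))
    (f : (singleFunctor 𝒜 0).obj A ⟶ ((singleFunctor 𝒜 0).obj N)⟦j⟧) : f = 0 := by
  subst hj
  exact (Abelian.Ext.homEquiv (X := A) (Y := N) (n := m)).symm.injective
    (Subsingleton.elim _ _)

lemma pure_zero [HasExt.{w'} 𝒜] (N : 𝒜)
    (ha : ∀ (A : 𝒜) (i : ℕ), 3 ≤ i → Subsingleton (Abelian.Ext A N i))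
    (W : DerivedCategory 𝒜) (n i : ℤ) (hn : 3 ≤ i + n) (h₁ : W.IsGE n) (h₂ : W.IsLE n)
    (f : W ⟶ ((singleFunctor 𝒜 0).obj N)⟦i⟧) : f = 0 := by
  refine hom_zero_of_shift W _ n i _ rfl (fun g => ?_) f
  have : (W⟦n⟧).IsGE 0 := TStructure.t.isGE_shift W n n 0
  have : (W⟦n⟧).IsLE 0 := TStructure.t.isLE_shift W n n 0
  obtain ⟨A, ⟨e⟩⟩ := exists_iso_singleFunctor_obj_of_isGE_of_isLE (W⟦n⟧) 0
  rw [← cancel_epi e.inv, comp_zero]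
  exact ext_zero A N (i + n).toNat _ (by omega) (ha _ _ (by omega)) _

lemma bounded_zero [HasExt.{w'} 𝒜] (N : 𝒜)
    (ha : ∀ (A : 𝒜) (i : ℕ), 3 ≤ i → Subsingleton (Abelian.Ext A N i)) (m : ℕ) :
    ∀ (W : DerivedCategory 𝒜) (n i : ℤ) (_ : 3 ≤ i + n) (_ : W.IsGE n) (_ : W.IsLE (n + m))
    (f : W ⟶ ((singleFunctor 𝒜 0).obj N)⟦i⟧), f = 0 := by
  induction m with
  | zero =>
    intro W n i hn h₁ h₂ f
    exact pure_zero N ha W n i hn h₁ (by simpa using h₂) f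
  | succ m ih =>
    intro W n i hn h₁ h₂ f
    refine devissage (TStructure.t.triangleLEGE_distinguished n (n + 1) rfl W)
      (fun a => ?_) (fun a => ?_) f
    · exact pure_zero N ha _ n i hn inferInstance inferInstance a
    · refine ih _ (n + 1) i (by omega) inferInstance ?_ a
      have : W.IsLE (n + 1 + m) := by
        have e : n + 1 + (m : ℤ) = n + ((m + 1 : ℕ) : ℤ) := by push_cast; ring
        rw [e]; exact h₂
      infer_instance

lemma Z_zero [HasExt.{w'} 𝒜] (N : 𝒜)
    (ha : ∀ (A : 𝒜) (i : ℕ), 3 ≤ i → Subsingleton (Abelian.Ext A N i))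
    (hb : ∀ A : 𝒜, (∀ X : 𝒜, (∀ g : X ⟶ N, g = 0) → ∀ h : X ⟶ A, h = 0) →
      Subsingleton (Abelian.Ext A N 2))
    (Z : DerivedCategory 𝒜)
    (hbdZ : ∃ a b : ℤ, ∀ i : ℤ, (i < a ∨ b < i) → IsZero ((homologyFunctor 𝒜 i).obj Z))
    (hZ₁ : ∀ i : ℤ, i < 0 → IsZero ((homologyFunctor 𝒜 i).obj Z))
    (hZ₂ : ∀ X' : 𝒜, (∀ g : X' ⟶ N, g = 0) →
      ∀ h : X' ⟶ (homologyFunctor 𝒜 0).obj Z, h = 0)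
    (i : ℤ) (hi : 2 ≤ i) (f : Z ⟶ ((singleFunctor 𝒜 0).obj N)⟦i⟧) : f = 0 := by
  have hGE : Z.IsGE 0 := (isGE_iff Z 0).2 hZ₁
  have hT := TStructure.t.triangleLEGE_distinguished 0 1 (by omega) Z
  refine devissage hT (fun a => ?_) (fun a => ?_) f
  · obtain ⟨A, ⟨e⟩⟩ := exists_iso_singleFunctor_obj_of_isGE_of_isLE
      ((TStructure.t.truncLE 0).obj Z) 0
    rw [← cancel_epi e.inv, comp_zero]
    refine ext_zero A N i.toNat _ (by omega) ?_ _
    by_cases h3 : 3 ≤ i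
    · exact ha _ _ (by omega)
    · obtain rfl : i = 2 := by omega
      refine hb A fun X' hX' h => ?_
      have hm : Mono ((homologyFunctor 𝒜 0).map ((TStructure.t.truncLEι 0).app Z)) := by
        refine (HomologySequence.mono_homologyMap_mor₁_iff _ hT (-1) 0 (by omega)).2 ?_
        exact (isZero_of_isGE ((TStructure.t.truncGE 1).obj Z) 1 (-1) (by omega)).eq_of_src _ _
      let e' : A ≅ (homologyFunctor 𝒜 0).obj ((TStructure.t.truncLE 0).obj Z) :=
        ((singleFunctorCompHomologyFunctorIso 𝒜 0).app A).symm ≪≫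
          (homologyFunctor 𝒜 0).mapIso e.symm
      have := hZ₂ X' hX' (h ≫ e'.hom ≫
        (homologyFunctor 𝒜 0).map ((TStructure.t.truncLEι 0).app Z))
      have h2 := zero_of_comp_mono _ ((Category.assoc _ _ _).trans this)
      exact zero_of_comp_mono _ h2
  · obtain ⟨_, b, hab⟩ := hbdZ
    have : Z.IsLE (1 + (b.toNat : ℤ)) :=
      (isLE_iff Z _).2 (fun j hj => hab j (Or.inr (by omega)))
    exact bounded_zero N ha b.toNat _ 1 i (by omega) inferInstance inferInstance a

lemma Y_zero (N : 𝒜) (Y : DerivedCategory 𝒜)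
    (hY₁ : ∀ i : ℤ, 0 < i → IsZero ((homologyFunctor 𝒜 i).obj Y))
    (hY₂ : ∀ g : (homologyFunctor 𝒜 0).obj Y ⟶ N, g = 0)
    (i : ℤ) (hi : i ≤ 0) (f : Y ⟶ ((singleFunctor 𝒜 0).obj N)⟦i⟧) : f = 0 := by
  have hLE : Y.IsLE 0 := (isLE_iff Y 0).2 hY₁
  have hN : (((singleFunctor 𝒜 0).obj N)⟦i⟧).IsGE (-i) := TStructure.t.isGE_shift _ 0 i (-i)
  by_cases h0 : i < 0
  · exact TStructure.t.zero f 0 (-i)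
  obtain rfl : i = 0 := by omega
  have hT := TStructure.t.triangleLEGE_distinguished (-1) 0 (by omega) Y
  refine devissage hT (fun a => ?_) (fun a => ?_) f
  · change (TStructure.t.truncLE (-1)).obj Y ⟶ _ at a
    exact TStructure.t.zero a (-1) (-0)
  · change (TStructure.t.truncGE 0).obj Y ⟶ _ at a
    obtain ⟨A, ⟨e⟩⟩ := exists_iso_singleFunctor_obj_of_isGE_of_isLE
      ((TStructure.t.truncGE 0).obj Y) 0
    rw [← cancel_epi e.inv, comp_zero,
      ← cancel_mono ((shiftFunctorZero (DerivedCategory 𝒜) ℤ).hom.app _), zero_comp]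
    obtain ⟨g, hg⟩ := (singleFunctor 𝒜 0).map_surjective
      ((e.inv ≫ a) ≫ (shiftFunctorZero (DerivedCategory 𝒜) ℤ).hom.app _)
    rw [← hg]
    have hm : Epi ((homologyFunctor 𝒜 0).map ((TStructure.t.truncGEπ 0).app Y)) := by
      refine (HomologySequence.epi_homologyMap_mor₂_iff _ hT 0 1 (by omega)).2 ?_
      exact (isZero_of_isLE ((TStructure.t.truncLE (-1)).obj Y) (-1) 1 (by omega)).eq_of_tgt _ _
    let e' : (homologyFunctor 𝒜 0).obj ((TStructure.t.truncGE 0).obj Y) ≅ A :=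
      (homologyFunctor 𝒜 0).mapIso e ≪≫ (singleFunctorCompHomologyFunctorIso 𝒜 0).app A
    have := hY₂ ((homologyFunctor 𝒜 0).map ((TStructure.t.truncGEπ 0).app Y) ≫ e'.hom ≫ g)
    have h2 := zero_of_epi_comp _ this
    have h3 : g = 0 := zero_of_epi_comp _ h2
    rw [h3, Functor.map_zero]

end PervOrth

/-- Let `k` be a field, `𝒜` a `k`-linear abelian category with enough injectives and
`N ∈ 𝒜`; let `T = {T : Hom(T,N) = 0}` and `F = T^⊥`.  Assume `Ext^i(A,N) = 0` for all
`A` and `i ≥ 3`, and `Ext²(A,N) = 0` for `A ∈ F`.  Given a distinguished triangle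
`Y → X → Z → Y[1]` of objects with bounded cohomology with `Y ∈ D^p_{≤0}` and
`Z ∈ D^p_{≥1}`, if `RHom(X,N) = 0` then `RHom(Y,N) = 0` and `RHom(Z,N) = 0`. -/
theorem perverse_truncations_of_orthogonal_are_orthogonal
    {k : Type u'} [Field k]
    {𝒜 : Type u} [Category.{v} 𝒜] [Abelian 𝒜] [Linear k 𝒜] [EnoughInjectives 𝒜]
    [HasDerivedCategory.{w} 𝒜] [HasExt.{w'} 𝒜]
    (N : 𝒜)
    (ha : ∀ (A : 𝒜) (i : ℕ), 3 ≤ i → Subsingleton (Abelian.Ext A N i))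
    (hb : ∀ A : 𝒜, (∀ X : 𝒜, (∀ g : X ⟶ N, g = 0) → ∀ h : X ⟶ A, h = 0) →
      Subsingleton (Abelian.Ext A N 2))
    (Y X Z : DerivedCategory 𝒜)
    (u : Y ⟶ X) (v : X ⟶ Z) (w : Z ⟶ Y⟦(1 : ℤ)⟧)
    (hT : Triangle.mk u v w ∈ distTriang (DerivedCategory 𝒜))
    (hbdY : ∃ a b : ℤ, ∀ i : ℤ, (i < a ∨ b < i) →
      IsZero ((DerivedCategory.homologyFunctor 𝒜 i).obj Y))
    (hbdX : ∃ a b : ℤ, ∀ i : ℤ, (i < a ∨ b < i) →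
      IsZero ((DerivedCategory.homologyFunctor 𝒜 i).obj X))
    (hbdZ : ∃ a b : ℤ, ∀ i : ℤ, (i < a ∨ b < i) →
      IsZero ((DerivedCategory.homologyFunctor 𝒜 i).obj Z))
    (hY₁ : ∀ i : ℤ, 0 < i → IsZero ((DerivedCategory.homologyFunctor 𝒜 i).obj Y))
    (hY₂ : ∀ g : (DerivedCategory.homologyFunctor 𝒜 0).obj Y ⟶ N, g = 0)
    (hZ₁ : ∀ i : ℤ, i < 0 → IsZero ((DerivedCategory.homologyFunctor 𝒜 i).obj Z))
    (hZ₂ : ∀ X' : 𝒜, (∀ g : X' ⟶ N, g = 0) →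
      ∀ h : X' ⟶ (DerivedCategory.homologyFunctor 𝒜 0).obj Z, h = 0)
    (hX : ∀ i : ℤ, ∀ f : X ⟶ ((DerivedCategory.singleFunctor 𝒜 0).obj N)⟦i⟧, f = 0) :
    (∀ i : ℤ, ∀ f : Y ⟶ ((DerivedCategory.singleFunctor 𝒜 0).obj N)⟦i⟧, f = 0) ∧
    (∀ i : ℤ, ∀ f : Z ⟶ ((DerivedCategory.singleFunctor 𝒜 0).obj N)⟦i⟧, f = 0) := by
  have hZ : ∀ i : ℤ, 2 ≤ i →
      ∀ f : Z ⟶ ((DerivedCategory.singleFunctor 𝒜 0).obj N)⟦i⟧, f = 0 :=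
    PervOrth.Z_zero N ha hb Z hbdZ hZ₁ hZ₂
  have hY : ∀ i : ℤ, i ≤ 0 →
      ∀ f : Y ⟶ ((DerivedCategory.singleFunctor 𝒜 0).obj N)⟦i⟧, f = 0 :=
    PervOrth.Y_zero N Y hY₁ hY₂
  constructor
  · intro i f
    by_cases hi : i ≤ 0
    · exact hY i hi f
    · refine PervOrth.hom_zero_of_shift Y _ 1 i (i + 1) rfl (fun g => ?_) f
      exact PervOrth.devissage (rot_of_distTriang _ (rot_of_distTriang _ hT))
        (hZ (i + 1) (by omega))
        (PervOrth.shift_hom_zero X _ 1 i (i + 1) rfl (hX i)) g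
  · intro i f
    by_cases hi : 2 ≤ i
    · exact hZ i hi f
    · exact PervOrth.devissage (rot_of_distTriang _ hT) (hX i)
        (PervOrth.shift_hom_zero Y _ 1 (i - 1) i (by omega) (hY (i - 1) (by omega))) f
end
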